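/- Let f : ℝ^n → ℝ be L-smooth convex, and let (x^(k)) be the accelerated gradient method iterates with parameter sequence (A_k) and initial point x₀. Then for every w ∈ ℝ^n and every k ≥ 1, g(x^(k)) ≤ g(w) + 2‖w − x₀‖²/A_k. Consequently, if A_k → ∞ then g(x^(k)) → inf_{x ∈ ℝ^n} g(x) as k → ∞ (including the case inf g = −∞). -/

import Mathlib

open scoped InnerProductSpace
open Filter Topology

/-- Legendre–Fenchel conjugate of `f`, valued in `ℝ ∪ {∞}` (modeled in `EReal`). -/
noncomputable def fconj {n : ℕ} (f : EuclideanSpace ℝ (Fin n) → ℝ)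
    (p : EuclideanSpace ℝ (Fin n)) : EReal :=
  ⨆ x : EuclideanSpace ℝ (Fin n), ((⟪p, x⟫_ℝ - f x : ℝ) : EReal)

/-- Effective domain `dom f*` of the Legendre–Fenchel conjugate. -/
noncomputable def fconjDom {n : ℕ} (f : EuclideanSpace ℝ (Fin n) → ℝ) :
    Set (EuclideanSpace ℝ (Fin n)) := {p | fconj f p < ⊤}

/-- Dual divergence `D_f(x, p) = f x + f*(p) − ⟨p, x⟩` (meaningful for `p ∈ dom f*`). -/
noncomputable def dualDiv {n : ℕ} (f : EuclideanSpace ℝ (Fin n) → ℝ)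
    (x p : EuclideanSpace ℝ (Fin n)) : ℝ :=
  f x + (fconj f p).toReal - ⟪p, x⟫_ℝ

/-- `f` is `L`-smooth convex: convex, differentiable, with `L`-Lipschitz gradient. -/
def LSmoothConvex {n : ℕ} (L : ℝ) (f : EuclideanSpace ℝ (Fin n) → ℝ) : Prop :=
  ConvexOn ℝ Set.univ f ∧ Differentiable ℝ f ∧
    LipschitzWith (Real.toNNReal L) (fun x => gradient f x)

/-- First-order characterisation of convexity for a differentiable function. -/
theorem ConvexOn.add_inner_gradient_le {E : Type*} [NormedAddCommGroup E]
    [InnerProductSpace ℝ E] [CompleteSpace E] {f : E → ℝ} (hc : ConvexOn ℝ Set.univ f)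
    (hd : Differentiable ℝ f) (u v : E) :
    f u + ⟪gradient f u, v - u⟫_ℝ ≤ f v := by
  have hg : HasDerivAt (fun t : ℝ => f (AffineMap.lineMap u v t)) ⟪gradient f u, v - u⟫_ℝ 0 := by
    have h1 : HasGradientAt f (gradient f u) (AffineMap.lineMap u v (0 : ℝ)) := by
      simpa using (hd u).hasGradientAt
    exact h1.hasFDerivAt.comp_hasDerivAt (0 : ℝ) AffineMap.hasDerivAt_lineMap
  have hcl : ConvexOn ℝ Set.univ (fun t : ℝ => f (AffineMap.lineMap u v t)) := by
    simpa [Function.comp_def] using hc.comp_affineMap (AffineMap.lineMap u v)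
  have := hcl.le_slope_of_hasDerivAt (Set.mem_univ 0) (Set.mem_univ 1) zero_lt_one hg
  rw [slope_def_field, AffineMap.lineMap_apply_one, AffineMap.lineMap_apply_zero] at this
  linarith

/-- Quadratic upper bound for a function with Lipschitz gradient. -/
theorem Differentiable.le_add_inner_gradient_add_sq {E : Type*} [NormedAddCommGroup E]
    [InnerProductSpace ℝ E] [CompleteSpace E] {f : E → ℝ} {L : NNReal}
    (hd : Differentiable ℝ f) (hL : LipschitzWith L (gradient f)) (u v : E) :
    f (u + v) ≤ f u + ⟪gradient f u, v⟫_ℝ + L / 2 * ‖v‖ ^ 2 := by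
  have hderiv : ∀ t : ℝ, HasDerivAt
      (fun t : ℝ => f (u + t • v) - t * ⟪gradient f u, v⟫_ℝ - t ^ 2 * (L / 2 * ‖v‖ ^ 2))
      (⟪gradient f (u + t • v), v⟫_ℝ - ⟪gradient f u, v⟫_ℝ - t * (L * ‖v‖ ^ 2)) t := by
    intro t
    have h1 : HasDerivAt (fun t : ℝ => u + t • v) v t := by
      simpa using ((hasDerivAt_id t).smul_const v).const_add u
    have h2 := (hd (u + t • v)).hasGradientAt.hasFDerivAt.comp_hasDerivAt t h1
    have h3 := (hasDerivAt_id t).mul_const ⟪gradient f u, v⟫_ℝ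
    have h4 := ((hasDerivAt_id t).pow 2).mul_const ((L : ℝ) / 2 * ‖v‖ ^ 2)
    refine ((h2.sub h3).sub h4).congr_deriv ?_
    rw [InnerProductSpace.toDual_apply_apply]
    norm_num
    ring
  have hanti := antitoneOn_of_deriv_nonpos (convex_Icc (0 : ℝ) 1)
    (fun t _ => (hderiv t).continuousAt.continuousWithinAt)
    (fun t _ => (hderiv t).differentiableAt.differentiableWithinAt) (fun t ht => by
      rw [interior_Icc] at ht
      rw [(hderiv t).deriv, ← inner_sub_left]
      have h1 := real_inner_le_norm (gradient f (u + t • v) - gradient f u) v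
      have h2 := hL.dist_le_mul (u + t • v) u
      rw [dist_eq_norm, dist_eq_norm, add_sub_cancel_left, norm_smul, Real.norm_eq_abs,
        abs_of_pos ht.1] at h2
      have h3 := mul_le_mul_of_nonneg_right h2 (norm_nonneg v)
      nlinarith)
  have := hanti (Set.left_mem_Icc.2 zero_le_one) (Set.right_mem_Icc.2 zero_le_one) zero_le_one
  simp only [one_smul, zero_smul, add_zero] at this
  linarith

theorem mem_fconjDom_iff {n : ℕ} {f : EuclideanSpace ℝ (Fin n) → ℝ}
    {p : EuclideanSpace ℝ (Fin n)} :
    p ∈ fconjDom f ↔ ∃ M : ℝ, ∀ x, ⟪p, x⟫_ℝ - f x ≤ M := by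
  constructor
  · intro h
    obtain ⟨M, hM, -⟩ := EReal.lt_iff_exists_real_btwn.1 (show fconj f p < ⊤ from h)
    exact ⟨M, fun x => EReal.coe_le_coe_iff.1 ((le_iSup_of_le x le_rfl).trans hM.le)⟩
  · rintro ⟨M, hM⟩
    exact (iSup_le fun x => EReal.coe_le_coe_iff.2 (hM x)).trans_lt (EReal.coe_lt_top M)

theorem convex_fconjDom {n : ℕ} (f : EuclideanSpace ℝ (Fin n) → ℝ) :
    Convex ℝ (fconjDom f) := by
  intro p hp q hq a b ha hb hab
  rw [mem_fconjDom_iff] at *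
  obtain ⟨M, hM⟩ := hp
  obtain ⟨N, hN⟩ := hq
  refine ⟨a * M + b * N, fun x => ?_⟩
  have h1 := mul_le_mul_of_nonneg_left (hM x) ha
  have h2 := mul_le_mul_of_nonneg_left (hN x) hb
  rw [inner_add_left, real_inner_smul_left, real_inner_smul_left]
  have h3 : f x = a * f x + b * f x := by rw [← add_mul, hab, one_mul]
  linarith

theorem gradient_mem_fconjDom {n : ℕ} {f : EuclideanSpace ℝ (Fin n) → ℝ}
    (hc : ConvexOn ℝ Set.univ f) (hd : Differentiable ℝ f) (u : EuclideanSpace ℝ (Fin n)) :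
    gradient f u ∈ fconjDom f := by
  refine mem_fconjDom_iff.2 ⟨⟪gradient f u, u⟫_ℝ - f u, fun x => ?_⟩
  have := hc.add_inner_gradient_le hd u x
  rw [inner_sub_right] at this
  linarith

/-- The minimum-norm point `p` of a convex set satisfies `⟪p, q - p⟫ ≥ 0` on the set. -/
theorem Convex.inner_sub_nonneg_of_norm_le {E : Type*} [NormedAddCommGroup E]
    [InnerProductSpace ℝ E] {K : Set E} (hK : Convex ℝ K) {p : E} (hp : p ∈ K)
    (hmin : ∀ q ∈ K, ‖p‖ ≤ ‖q‖) {q : E} (hq : q ∈ K) : 0 ≤ ⟪p, q - p⟫_ℝ := by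
  have hne : Nonempty K := ⟨⟨p, hp⟩⟩
  have h : ‖(0 : E) - p‖ = ⨅ w : K, ‖(0 : E) - w‖ := by
    apply le_antisymm
    · exact le_ciInf fun w => by simpa using hmin w w.2
    · exact ciInf_le ⟨0, by rintro _ ⟨w, rfl⟩; positivity⟩ (⟨p, hp⟩ : K)
  have := (norm_eq_iInf_iff_real_inner_le_zero hK hp).1 h q hq
  simpa using this

/-- One step of the accelerated gradient method decreases the energy
`A (g x - g w) + 2 ‖z + (A / 4) q - w‖²` of the tilted function `g = f - ⟪q, ·⟫`, provided that
every gradient of `g` makes a nonnegative inner product with `q`. -/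
theorem accelerated_gradient_energy_step {E : Type*} [NormedAddCommGroup E]
    [InnerProductSpace ℝ E] [CompleteSpace E] {f : E → ℝ} {L : NNReal}
    (hc : ConvexOn ℝ Set.univ f) (hd : Differentiable ℝ f) (hL : LipschitzWith L (gradient f))
    {q : E} (hq : ∀ u, 0 ≤ ⟪q, gradient f u - q⟫_ℝ) {A A' : ℝ} (hA : 0 ≤ A) (hAA' : A < A')
    (hstep : L * (A' - A) ^ 2 ≤ 4 * A') {x y z x' z' : E}
    (hy : y = x + ((A' - A) / A') • (z - x)) (hz : z' = z - ((A' - A) / 4) • gradient f y)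
    (hx : x' = (A / A') • x + ((A' - A) / A') • z') (w : E) :
    A' * (f x' - ⟪q, x'⟫_ℝ - (f w - ⟪q, w⟫_ℝ)) + 2 * ‖z' + (A' / 4) • q - w‖ ^ 2 ≤
      A * (f x - ⟪q, x⟫_ℝ - (f w - ⟪q, w⟫_ℝ)) + 2 * ‖z + (A / 4) • q - w‖ ^ 2 := by
  have hA' : 0 < A' := hA.trans_lt hAA'
  obtain ⟨a, rfl⟩ : ∃ a, A = A' - a := ⟨A' - A, by ring⟩
  have ha0 : 0 < a := by linarith
  rw [sub_sub_cancel] at hstep hy hz hx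
  obtain ⟨G, hG⟩ : ∃ G, G = gradient f y - q := ⟨_, rfl⟩
  have hgy : gradient f y = G + q := by rw [hG]; abel
  have hGq : 0 ≤ ⟪q, G⟫_ℝ := hG ▸ hq y
  have hxs : x' + (a ^ 2 / (4 * A')) • q = y + (-(a ^ 2 / (4 * A'))) • G := by
    rw [hx, hz, hgy, hy]
    match_scalars <;> field_simp <;> ring
  -- moving along `q` does not decrease the tilted function
  have h1 : f x' + a ^ 2 / (4 * A') * ⟪q, q⟫_ℝ ≤ f (y + (-(a ^ 2 / (4 * A'))) • G) := by
    have h := hc.add_inner_gradient_le hd x' (x' + (a ^ 2 / (4 * A')) • q)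
    rw [add_sub_cancel_left, real_inner_smul_right, hxs] at h
    have h' := hq x'
    rw [inner_sub_right, real_inner_comm] at h'
    have h'' := mul_le_mul_of_nonneg_left (sub_nonneg.1 h')
      (show 0 ≤ a ^ 2 / (4 * A') by positivity)
    linarith
  have h2 := hd.le_add_inner_gradient_add_sq hL y ((-(a ^ 2 / (4 * A'))) • G)
  have h3 : L / 2 * ‖(-(a ^ 2 / (4 * A'))) • G‖ ^ 2 ≤ a ^ 2 / (8 * A') * ‖G‖ ^ 2 := by
    rw [norm_smul, mul_pow, Real.norm_eq_abs, sq_abs, ← mul_assoc]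
    refine mul_le_mul_of_nonneg_right ?_ (sq_nonneg _)
    have : (L : ℝ) / 2 * (-(a ^ 2 / (4 * A'))) ^ 2 = (L * a ^ 2) * (a ^ 2 / (32 * A' ^ 2)) := by
      field_simp
      ring
    rw [this]
    refine (mul_le_mul_of_nonneg_right hstep (by positivity)).trans_eq ?_
    field_simp
    ring
  have h4 := mul_le_mul_of_nonneg_left (hc.add_inner_gradient_le hd y x) hA
  have h5 := mul_le_mul_of_nonneg_left (hc.add_inner_gradient_le hd y w) ha0.le
  have h6 : A' * f x' + a ^ 2 / 4 * ⟪q, q⟫_ℝ ≤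
      A' * f y - a ^ 2 / 4 * ⟪G + q, G⟫_ℝ + a ^ 2 / 8 * ‖G‖ ^ 2 := by
    rw [hgy, real_inner_smul_right] at h2
    have h := mul_le_mul_of_nonneg_left (h1.trans (h2.trans (add_le_add_right h3 _))) hA'.le
    have e1 : A' * (f x' + a ^ 2 / (4 * A') * ⟪q, q⟫_ℝ) = A' * f x' + a ^ 2 / 4 * ⟪q, q⟫_ℝ := by
      field_simp
    have e2 : A' * (f y + -(a ^ 2 / (4 * A')) * ⟪G + q, G⟫_ℝ + a ^ 2 / (8 * A') * ‖G‖ ^ 2) =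
        A' * f y - a ^ 2 / 4 * ⟪G + q, G⟫_ℝ + a ^ 2 / 8 * ‖G‖ ^ 2 := by
      field_simp
      ring
    rwa [e1, e2] at h
  have hAy : A' • y = (A' - a) • x + a • z := by
    rw [hy]
    match_scalars <;> field_simp
    ring
  have hAx : A' • x' = (A' - a) • x + a • z - (a ^ 2 / 4) • (G + q) := by
    rw [hx, hz, hgy]
    match_scalars <;> field_simp
  have h7 : (A' - a) * ⟪gradient f y, x - y⟫_ℝ + a * ⟪gradient f y, w - y⟫_ℝ =
      a * ⟪G + q, w - z⟫_ℝ := by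
    rw [hgy, ← real_inner_smul_right, ← real_inner_smul_right, ← real_inner_smul_right,
      ← inner_add_right]
    congr 1
    have : (A' - a) • (x - y) + a • (w - y) = (A' - a) • x + a • w - A' • y := by module
    rw [this, hAy]
    module
  have h8 : A' * ⟪q, x'⟫_ℝ = (A' - a) * ⟪q, x⟫_ℝ + a * ⟪q, z⟫_ℝ - a ^ 2 / 4 * ⟪q, G + q⟫_ℝ := by
    rw [← real_inner_smul_right, hAx, inner_sub_right, inner_add_right, real_inner_smul_right,
      real_inner_smul_right, real_inner_smul_right]
  have h9 : z' + (A' / 4) • q - w = (z + ((A' - a) / 4) • q - w) - (a / 4) • G := by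
    rw [hz, hgy]
    module
  rw [h9, norm_sub_sq_real (z + ((A' - a) / 4) • q - w), norm_smul, mul_pow, Real.norm_eq_abs,
    sq_abs, real_inner_smul_right, inner_sub_left (z + ((A' - a) / 4) • q), inner_add_left z,
    real_inner_smul_left q]
  have h10 := mul_nonneg (mul_nonneg ha0.le hA) hGq
  simp only [inner_add_left, inner_add_right, inner_sub_right, real_inner_self_eq_norm_sq]
    at h4 h5 h6 h7 h8
  rw [real_inner_comm z G, real_inner_comm w G] at h7
  linarith

/-- for the accelerated gradient method,
`g(x^(k)) ≤ g(w) + 2‖w − x₀‖²/A_k` for every `w` and `k ≥ 1`; consequently, if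
`A_k → ∞` then `g(x^(k)) → inf g` (in `EReal`, covering `inf g = −∞`). -/
theorem stmt17 {n : ℕ} (hn : 1 ≤ n) (L : ℝ) (hL : 0 < L)
    (f : EuclideanSpace ℝ (Fin n) → ℝ) (hf : LSmoothConvex L f)
    (A : ℕ → ℝ) (hA0 : A 0 = 0) (hAmono : ∀ k, A k < A (k + 1))
    (hAstep : ∀ k, L * (A (k + 1) - A k) ^ 2 ≤ 4 * A (k + 1))
    (x₀ : EuclideanSpace ℝ (Fin n))
    (x y z : ℕ → EuclideanSpace ℝ (Fin n))
    (hx0 : x 0 = x₀) (hz0 : z 0 = x₀)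
    (hy : ∀ k, y k = x k + ((A (k + 1) - A k) / A (k + 1)) • (z k - x k))
    (hzs : ∀ k, z (k + 1) = z k - ((A (k + 1) - A k) / 4) • gradient f (y k))
    (hxs : ∀ k, x (k + 1) =
      (A k / A (k + 1)) • x k + ((A (k + 1) - A k) / A (k + 1)) • z (k + 1))
    (pstar : EuclideanSpace ℝ (Fin n))
    (hps : pstar ∈ closure (fconjDom f))
    (hmin : ∀ q ∈ closure (fconjDom f), ‖pstar‖ ≤ ‖q‖) :
    (∀ w, ∀ k : ℕ, 1 ≤ k →
      f (x k) - ⟪pstar, x k⟫_ℝ ≤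
        (f w - ⟪pstar, w⟫_ℝ) + 2 * ‖w - x₀‖ ^ 2 / A k) ∧
    (Tendsto A atTop atTop →
      Tendsto (fun k : ℕ => ((f (x k) - ⟪pstar, x k⟫_ℝ : ℝ) : EReal)) atTop
        (nhds (⨅ v : EuclideanSpace ℝ (Fin n), ((f v - ⟪pstar, v⟫_ℝ : ℝ) : EReal)))) := by
  obtain ⟨hc, hd, hlip⟩ := hf
  have hq : ∀ u, 0 ≤ ⟪pstar, gradient f u - pstar⟫_ℝ := fun u =>
    (convex_fconjDom f).closure.inner_sub_nonneg_of_norm_le hps hmin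
      (subset_closure (gradient_mem_fconjDom hc hd u))
  have hAnn : ∀ k, 0 ≤ A k := fun k =>
    hA0 ▸ (strictMono_nat_of_lt_succ hAmono).monotone (Nat.zero_le k)
  have henergy : ∀ w k, A k * (f (x k) - ⟪pstar, x k⟫_ℝ - (f w - ⟪pstar, w⟫_ℝ)) +
      2 * ‖z k + (A k / 4) • pstar - w‖ ^ 2 ≤ 2 * ‖w - x₀‖ ^ 2 := by
    intro w k
    induction k with
    | zero => simp [hA0, hz0, norm_sub_rev]
    | succ k ih =>
      refine (accelerated_gradient_energy_step hc hd hlip hq (hAnn k) (hAmono k) ?_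
        (hy k) (hzs k) (hxs k) w).trans ih
      rw [Real.coe_toNNReal L hL.le]
      exact hAstep k
  have hbound : ∀ w, ∀ k : ℕ, 1 ≤ k → f (x k) - ⟪pstar, x k⟫_ℝ ≤
      (f w - ⟪pstar, w⟫_ℝ) + 2 * ‖w - x₀‖ ^ 2 / A k := by
    intro w k hk
    have hAk : 0 < A k := hA0 ▸ strictMono_nat_of_lt_succ hAmono hk
    rw [← sub_le_iff_le_add', le_div_iff₀' hAk]
    exact (le_add_of_nonneg_right (by positivity)).trans (henergy w k)
  refine ⟨hbound, fun hA => tendsto_order.2 ⟨fun b hb => ?_, fun b hb => ?_⟩⟩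
  · exact Eventually.of_forall fun k => hb.trans_le (iInf_le _ (x k))
  · obtain ⟨w, hw⟩ := iInf_lt_iff.1 hb
    have hlim : Tendsto (fun k => (f w - ⟪pstar, w⟫_ℝ) + 2 * ‖w - x₀‖ ^ 2 / A k) atTop
        (𝓝 (f w - ⟪pstar, w⟫_ℝ)) := by
      simpa using (hA.const_div_atTop (2 * ‖w - x₀‖ ^ 2)).const_add (f w - ⟪pstar, w⟫_ℝ)
    have hlim' := (continuous_coe_real_ereal.tendsto _).comp hlim
    filter_upwards [hlim'.eventually (gt_mem_nhds hw), eventually_ge_atTop 1] with k hk h1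
    exact (EReal.coe_le_coe_iff.2 (hbound w k h1)).trans_lt hk
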